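/- Ordering the circles of each configuration by increasing radius defines an embedding 𝒰ℛ^<_n ↪ 𝒫𝒰ℛ_n, and the induced homomorphism on fundamental groups π₁𝒰ℛ^<_n → π₁𝒫𝒰ℛ_n is injective. -/

import Mathlib

noncomputable section

open CategoryTheory

abbrev E2 : Type := EuclideanSpace ℝ (Fin 2)
abbrev E3 : Type := EuclideanSpace ℝ (Fin 3)

/-- The round circle in `ℝ³` with center `c`, radius `r` and normal `v`. -/
def circleSet (c : E3) (r : ℝ) (v : E3) : Set E3 :=
  {x | ‖x - c‖ = r ∧ inner ℝ (x - c) v = (0 : ℝ)}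

/-- The spanning disk of the round circle with center `c`, radius `r` and normal `v`. -/
def diskSet (c : E3) (r : ℝ) (v : E3) : Set E3 :=
  {x | ‖x - c‖ ≤ r ∧ inner ℝ (x - c) v = (0 : ℝ)}

/-- The circle determined by a parameter pair (center, normal vector `w`):
it has radius `‖w‖` and unit normal `w / ‖w‖` (so `w` and `-w` give the same circle). -/
def pCircle (p : E3 × E3) : Set E3 := circleSet p.1 ‖p.2‖ p.2

/-- The spanning disk of the circle determined by a parameter pair. -/
def pDisk (p : E3 × E3) : Set E3 := diskSet p.1 ‖p.2‖ p.2

/-- The first circle meets the spanning disk of the second in exactly one point. -/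
def LinksOnce (p q : E3 × E3) : Prop := ∃! x, x ∈ pCircle p ∩ pDisk q

/-- Two round circles are unlinked if neither meets the spanning disk of the other in
exactly one point. -/
def UnlinkedPair (p q : E3 × E3) : Prop := ¬ LinksOnce p q ∧ ¬ LinksOnce q p

/-- An `n`-tuple of parameters of (nondegenerate) pairwise disjoint, pairwise unlinked
round circles. -/
def IsRingTuple {n : ℕ} (f : Fin n → E3 × E3) : Prop :=
  (∀ i, (f i).2 ≠ 0) ∧
  (∀ i j, i ≠ j → Disjoint (pCircle (f i)) (pCircle (f j))) ∧
  (∀ i j, i ≠ j → UnlinkedPair (f i) (f j))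

/-- The space of ordered `n`-tuples of disjoint pairwise unlinked round circles. -/
abbrev RingTuple (n : ℕ) : Type := {f : Fin n → E3 × E3 // IsRingTuple f}

/-- Two tuples are identified iff they determine the same `n`-element set of circles
(this identifies `w` with `-w` and permutes the circles). -/
def ringSetoid (n : ℕ) : Setoid (RingTuple n) where
  r f g := (Set.range fun i => pCircle (f.1 i)) = Set.range fun i => pCircle (g.1 i)
  iseqv := ⟨fun _ => rfl, Eq.symm, Eq.trans⟩

/-- The space `ℛ_n` of configurations of `n` disjoint pairwise unlinked round circles
in `ℝ³`, with the quotient topology. -/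
abbrev RingConf (n : ℕ) : Type := Quotient (ringSetoid n)

/-- All circles of the tuple lie in planes parallel to the `yz`-plane, i.e. every
normal vector is parallel to `(1,0,0)`. -/
def IsUntwistedTuple {n : ℕ} (f : RingTuple n) : Prop :=
  ∀ i, (f.1 i).2 1 = 0 ∧ (f.1 i).2 2 = 0

/-- All circles of the tuple lie in vertical planes, i.e. every normal vector is
horizontal (third coordinate zero). -/
def IsVerticalTuple {n : ℕ} (f : RingTuple n) : Prop := ∀ i, (f.1 i).2 2 = 0

/-- The untwisted ring space `𝒰ℛ_n ⊆ ℛ_n`: configurations of rings parallel to the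
`yz`-plane. -/
def URConf (n : ℕ) : Set (RingConf n) :=
  {x | ∃ f, Quotient.mk (ringSetoid n) f = x ∧ IsUntwistedTuple f}

/-- The vertical ring space `𝒱ℛ_n ⊆ ℛ_n`: configurations of rings in vertical planes. -/
def VRConf (n : ℕ) : Set (RingConf n) :=
  {x | ∃ f, Quotient.mk (ringSetoid n) f = x ∧ IsVerticalTuple f}

/-- The homomorphism on fundamental groups induced by a continuous map. -/
def pi1Map {X Y : Type} [TopologicalSpace X] [TopologicalSpace Y] (f : C(X, Y)) (x : X) :
    Aut (FundamentalGroupoid.mk x) →* Aut (FundamentalGroupoid.mk (f x)) :=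
  CategoryTheory.Functor.mapAut (FundamentalGroupoid.mk x)
    (FundamentalGroupoid.fundamentalGroupoidFunctor.map
      (show TopCat.of X ⟶ TopCat.of Y from TopCat.ofHom f))

/-- The ordered (labeled) untwisted ring space `𝒫𝒰ℛ_n`. -/
abbrev PURTuple (n : ℕ) : Type := {f : RingTuple n // IsUntwistedTuple f}

/-- The subspace `𝒰ℛ^<_n ⊆ 𝒰ℛ_n` of configurations of untwisted rings of pairwise
distinct radii. -/
def URlt (n : ℕ) : Set (RingConf n) :=
  {x | ∃ f, Quotient.mk (ringSetoid n) f = x ∧ IsUntwistedTuple f ∧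
    Function.Injective fun i => ‖(f.1 i).2‖}

open scoped unitInterval

/-- Distance-like function to the round circle `(c,r)` parallel to the `yz`-plane. -/
def gd (p : E3 × ℝ) (y : E3) : ℝ := |y 0 - p.1 0| + |‖y - p.1‖ - p.2|

/-- Gap between two parallel circles. -/
def gm (p q : E3 × ℝ) : ℝ :=
  |p.1 0 - q.1 0| + max 0 (max (‖p.1 - q.1‖ - p.2 - q.2) (|p.2 - q.2| - ‖p.1 - q.1‖))

def Valid {n : ℕ} (b : Fin n → E3 × ℝ) : Prop :=
  (∀ i, 0 < (b i).2) ∧ ∀ i j, i ≠ j → 0 < gm (b i) (b j)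

def RingsOf {n : ℕ} (b : Fin n → E3 × ℝ) : Set E3 := {y | ∃ i, gd (b i) y = 0}

lemma coord_le (y : E3) (i : Fin 3) : |y i| ≤ ‖y‖ := by
  have := PiLp.norm_apply_le y i
  simpa using this

lemma gd_nonneg (p : E3 × ℝ) (y : E3) : 0 ≤ gd p y := by unfold gd; positivity

lemma gd_eq_zero {p : E3 × ℝ} {y : E3} : gd p y = 0 ↔ y 0 = p.1 0 ∧ ‖y - p.1‖ = p.2 := by
  unfold gd
  rw [add_eq_zero_iff_of_nonneg (abs_nonneg _) (abs_nonneg _), abs_eq_zero, abs_eq_zero,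
    sub_eq_zero, sub_eq_zero]

@[fun_prop]
lemma gd_cont : Continuous fun x : (E3 × ℝ) × E3 => gd x.1 x.2 := by
  unfold gd; fun_prop

lemma gm_cont : Continuous fun x : (E3 × ℝ) × (E3 × ℝ) => gm x.1 x.2 := by
  unfold gm; fun_prop

lemma gd_lip (p : E3 × ℝ) (y z : E3) : |gd p y - gd p z| ≤ 2 * ‖y - z‖ := by
  unfold gd
  have h1 : |(y 0 - p.1 0) - (z 0 - p.1 0)| ≤ ‖y - z‖ := by
    have := coord_le (y - z) 0
    simpa using this
  have h2 : |‖y - p.1‖ - ‖z - p.1‖| ≤ ‖y - z‖ := by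
    have := abs_norm_sub_norm_le (y - p.1) (z - p.1)
    simpa using this
  have h3 := abs_abs_sub_abs_le_abs_sub (y 0 - p.1 0) (z 0 - p.1 0)
  have h4 := abs_abs_sub_abs_le_abs_sub (‖y - p.1‖ - p.2) (‖z - p.1‖ - p.2)
  have h5 : (‖y - p.1‖ - p.2) - (‖z - p.1‖ - p.2) = ‖y - p.1‖ - ‖z - p.1‖ := by ring
  rw [h5] at h4
  rw [abs_le] at *
  constructor <;> linarith [h1.1, h1.2, h2.1, h2.2, h3.1, h3.2, h4.1, h4.2, le_abs_self (y 0 - p.1 0 - (z 0 - p.1 0)), abs_le.2 h1, abs_le.2 h2]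

/-- a point on circle `q` has `gd` at least `gm` to circle `p`. -/
lemma gm_le_gd (p q : E3 × ℝ) (y : E3) (hy : gd q y = 0) : gm p q ≤ gd p y := by
  rw [gd_eq_zero] at hy
  unfold gm gd
  rw [hy.1, abs_sub_comm]
  have a1 : ‖y - p.1‖ ≤ ‖p.1 - q.1‖ + q.2 := by
    rw [← hy.2]
    have := norm_sub_le (y - q.1) (p.1 - q.1)
    simp at this; linarith
  have a2 : ‖p.1 - q.1‖ ≤ ‖y - p.1‖ + q.2 := by
    rw [← hy.2]
    have := norm_sub_le (y - q.1) (y - p.1)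
    simp at this; linarith
  have a3 : q.2 ≤ ‖y - p.1‖ + ‖p.1 - q.1‖ := by
    rw [← hy.2]
    have := norm_add_le (y - p.1) (p.1 - q.1)
    simpa using this
  gcongr
  refine max_le (abs_nonneg _) (max_le ?_ ?_)
  · have := le_abs_self (‖y - p.1‖ - p.2); linarith
  · rcases abs_cases (p.2 - q.2) with h | h <;> rcases abs_cases (‖y - p.1‖ - p.2) with h' | h' <;> linarith

/-- family of perturbations of the identity is a family of homeomorphisms -/
lemma perturb {P : Type*} [TopologicalSpace P] (g : P × E3 → E3) (hg : Continuous g)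
    (hl : ∀ p y z, ‖g (p, y) - g (p, z)‖ ≤ (1/2) * ‖y - z‖) :
    ∃ Ψ : P × E3 → E3, Continuous Ψ ∧ (∀ p y, Ψ (p, y + g (p, y)) = y) ∧
      (∀ p y, Ψ (p, y) + g (p, Ψ (p, y)) = y) := by
  have anti : ∀ p y z, ‖y - z‖ ≤ 2 * ‖(y + g (p, y)) - (z + g (p, z))‖ := by
    intro p y z
    have h := hl p y z
    have : y - z = ((y + g (p, y)) - (z + g (p, z))) - (g (p, y) - g (p, z)) := by abel
    have h2 := norm_sub_le ((y + g (p, y)) - (z + g (p, z))) (g (p, y) - g (p, z))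
    rw [← this] at h2
    linarith
  have ex : ∀ x : P × E3, ∃ y, y + g (x.1, y) = x.2 := by
    rintro ⟨p, z⟩
    have hc : ContractingWith (1/2 : NNReal) (fun y => z - g (p, y)) := by
      refine ⟨?_, ?_⟩
      · rw [← NNReal.coe_lt_coe]; norm_num
      · refine LipschitzWith.of_dist_le_mul fun a b => ?_
        rw [dist_eq_norm, dist_eq_norm]
        have := hl p b a
        rw [norm_sub_rev b a] at this
        simpa using this
    refine ⟨ContractingWith.fixedPoint _ hc, ?_⟩
    have := hc.fixedPoint_isFixedPt
    unfold Function.IsFixedPt at this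
    nth_rewrite 1 [← this]
    simp
  choose Ψ hΨ using ex
  refine ⟨Ψ, ?_, ?_, fun p y => hΨ (p, y)⟩
  · rw [continuous_iff_continuousAt]
    intro x0
    rw [ContinuousAt, tendsto_iff_norm_sub_tendsto_zero]
    have hb : ∀ x : P × E3, ‖Ψ x - Ψ x0‖ ≤ 2 * ‖x.2 - (Ψ x0 + g (x.1, Ψ x0))‖ := by
      intro x
      have := anti x.1 (Ψ x) (Ψ x0)
      rwa [hΨ x] at this
    refine squeeze_zero (fun _ => norm_nonneg _) hb ?_
    have hc : Continuous fun x : P × E3 => 2 * ‖x.2 - (Ψ x0 + g (x.1, Ψ x0))‖ := by fun_prop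
    have := hc.tendsto x0
    rwa [hΨ x0, sub_self, norm_zero, mul_zero] at this
  · intro p y
    have := anti p (Ψ (p, y + g (p, y))) y
    rw [hΨ (p, y + g (p, y))] at this
    simp at this
    exact sub_eq_zero.1 this

/-- transport of ring complements -/
def Tr {n : ℕ} {P : Type*} [TopologicalSpace P] (Z : Set P) (R : ℝ)
    (b0 b1 : P → Fin n → E3 × ℝ) : Prop :=
  ∃ Φ Ψ : P × E3 → E3, Continuous Φ ∧ Continuous Ψ ∧ (∀ p y, Ψ (p, Φ (p, y)) = y) ∧
    (∀ p y, Φ (p, Ψ (p, y)) = y) ∧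
    (∀ p y, y ∈ RingsOf (b0 p) ↔ Φ (p, y) ∈ RingsOf (b1 p)) ∧
    (∀ p ∈ Z, ∀ y, Φ (p, y) = y) ∧ (∀ p y, R ≤ ‖y‖ → Φ (p, y) = y)

lemma Tr.refl {n : ℕ} {P : Type*} [TopologicalSpace P] (Z : Set P) (R : ℝ)
    (b : P → Fin n → E3 × ℝ) : Tr Z R b b :=
  ⟨Prod.snd, Prod.snd, by fun_prop, by fun_prop, by simp, by simp, by simp, by simp, by simp⟩

lemma Tr.trans {n : ℕ} {P : Type*} [TopologicalSpace P] {Z : Set P} {R : ℝ}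
    {b0 b1 b2 : P → Fin n → E3 × ℝ} (h : Tr Z R b0 b1) (h' : Tr Z R b1 b2) : Tr Z R b0 b2 := by
  obtain ⟨Φ, Ψ, c1, c2, i1, i2, r, z, f⟩ := h
  obtain ⟨Φ', Ψ', c1', c2', i1', i2', r', z', f'⟩ := h'
  refine ⟨fun x => Φ' (x.1, Φ x), fun x => Ψ (x.1, Ψ' x), by fun_prop, by fun_prop, ?_, ?_, ?_, ?_, ?_⟩
  · intro p y; simp [i1, i1']
  · intro p y; simp [i2, i2']
  · intro p y; rw [r, r']
  · intro p hp y; simp [z p hp, z' p hp]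
  · intro p y hy; simp [f p y hy, f' p y hy]

/-- the cut-off -/
def cut (ε : ℝ) (p : E3 × ℝ) (y : E3) : ℝ := max 0 (1 - gd p y / ε)

/-- displacement -/
def disp (p q : E3 × ℝ) (y : E3) : E3 := (q.1 - p.1) + (q.2 / p.2 - 1) • (y - p.1)

lemma cutdisp_lip {ε R η : ℝ} (hε : 0 < ε) (hη : 0 ≤ η) (p q : E3 × ℝ)
    (hp : ε ≤ p.2) (hR : ‖p.1‖ + p.2 + ε ≤ R) (h1 : ‖q.1 - p.1‖ ≤ η) (h2 : |q.2 - p.2| ≤ η)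
    (y z : E3) :
    ‖cut ε p y • disp p q y - cut ε p z • disp p q z‖ ≤
      (2 / ε * (η + η / ε * R) + η / ε) * ‖y - z‖ := by
  have hR0 : 0 ≤ R := by linarith [norm_nonneg p.1]
  have hp0 : 0 < p.2 := by linarith
  have hs : |q.2 / p.2 - 1| ≤ η / ε := by
    rw [div_sub_one hp0.ne', abs_div, abs_of_pos hp0]
    gcongr
  have key : ∀ y z : E3, 0 < cut ε p y → ‖cut ε p y • disp p q y - cut ε p z • disp p q z‖ ≤
      (2 / ε * (η + η / ε * R) + η / ε) * ‖y - z‖ := by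
    intro y z hy
    have hgy : gd p y < ε := by
      by_contra hcon
      push Not at hcon
      have : 1 ≤ gd p y / ε := by rwa [le_div_iff₀ hε, one_mul]
      unfold cut at hy
      rw [max_eq_left (by linarith)] at hy
      exact lt_irrefl _ hy
    have hyR : ‖y - p.1‖ ≤ R := by
      unfold gd at hgy
      have := le_abs_self (‖y - p.1‖ - p.2)
      linarith [abs_nonneg (y 0 - p.1 0), norm_nonneg p.1]
    have hd : ‖disp p q y‖ ≤ η + η / ε * R := by
      unfold disp
      refine (norm_add_le _ _).trans ?_
      rw [norm_smul, Real.norm_eq_abs]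
      gcongr
    have hdd : ‖disp p q y - disp p q z‖ ≤ η / ε * ‖y - z‖ := by
      have : disp p q y - disp p q z = (q.2 / p.2 - 1) • (y - z) := by
        unfold disp
        module
      rw [this, norm_smul, Real.norm_eq_abs]
      gcongr
    have hcz : |cut ε p z| ≤ 1 := by
      unfold cut
      rw [abs_of_nonneg (le_max_left _ _)]
      refine max_le zero_le_one ?_
      have : 0 ≤ gd p z / ε := div_nonneg (gd_nonneg _ _) hε.le
      linarith
    have hcc : |cut ε p y - cut ε p z| ≤ 2 / ε * ‖y - z‖ := by
      unfold cut
      refine (abs_max_sub_max_le_max _ _ _ _).trans ?_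
      have := gd_lip p z y
      have e : (1 - gd p y / ε) - (1 - gd p z / ε) = (gd p z - gd p y) / ε := by ring
      rw [e, sub_self, abs_zero, abs_div, abs_of_pos hε, norm_sub_rev y z]
      refine max_le (by positivity) ?_
      rw [div_mul_eq_mul_div]
      gcongr
    have e : cut ε p y • disp p q y - cut ε p z • disp p q z =
      (cut ε p y - cut ε p z) • disp p q y + cut ε p z • (disp p q y - disp p q z) := by module
    rw [e]
    refine (norm_add_le _ _).trans ?_
    rw [norm_smul, norm_smul, Real.norm_eq_abs, Real.norm_eq_abs]
    calc _ ≤ (2 / ε * ‖y - z‖) * (η + η / ε * R) + 1 * (η / ε * ‖y - z‖) := by gcongr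
      _ = _ := by ring
  have cn : ∀ y, 0 ≤ cut ε p y := fun y => le_max_left _ _
  rcases (cn y).eq_or_lt with h | h
  · rcases (cn z).eq_or_lt with h' | h'
    · rw [← h, ← h']; simp; positivity
    · rw [norm_sub_rev, norm_sub_rev y z]; exact key z y h'
  · exact key y z h

lemma small_step {n : ℕ} {P : Type*} [TopologicalSpace P] {Z : Set P} {R ε η : ℝ}
    (hε : 0 < ε) (hη : 0 ≤ η)
    (hsm : n * (2 / ε * (η + η / ε * R) + η / ε) ≤ 1 / 2)
    (b0 b1 : P → Fin n → E3 × ℝ) (c0 : Continuous b0) (c1 : Continuous b1)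
    (hr : ∀ p i, ε ≤ (b0 p i).2) (hr1 : ∀ p i, 0 < (b1 p i).2)
    (hR : ∀ p i, ‖(b0 p i).1‖ + (b0 p i).2 + ε ≤ R)
    (hm : ∀ p i j, i ≠ j → ε ≤ gm (b0 p i) (b0 p j))
    (hd : ∀ p i, ‖(b1 p i).1 - (b0 p i).1‖ ≤ η) (hd2 : ∀ p i, |(b1 p i).2 - (b0 p i).2| ≤ η)
    (hZ : ∀ p ∈ Z, b0 p = b1 p) : Tr Z R b0 b1 := by
  let g : P × E3 → E3 := fun x => ∑ i, cut ε (b0 x.1 i) x.2 • disp (b0 x.1 i) (b1 x.1 i) x.2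
  have hg : Continuous g := by
    refine continuous_finsetSum _ fun i _ => ?_
    have k1 : Continuous fun x : P × E3 => gd (b0 x.1 i) x.2 :=
      gd_cont.comp (f := fun x : P × E3 => ((b0 x.1 i), x.2)) (by fun_prop)
    have k2 : Continuous fun x : P × E3 => (b1 x.1 i).2 / (b0 x.1 i).2 :=
      Continuous.div (by fun_prop) (by fun_prop) (fun x => by have := hr x.1 i; linarith)
    unfold cut disp
    fun_prop
  have hl : ∀ p y z, ‖g (p, y) - g (p, z)‖ ≤ (1/2) * ‖y - z‖ := by
    intro p y z
    simp only [g]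
    rw [← Finset.sum_sub_distrib]
    refine (norm_sum_le _ _).trans ?_
    refine (Finset.sum_le_sum fun i _ => cutdisp_lip hε hη _ _ (hr p i) (hR p i) (hd p i) (hd2 p i) y z).trans ?_
    rw [Finset.sum_const, Finset.card_univ, Fintype.card_fin, nsmul_eq_mul, ← mul_assoc]
    gcongr
  obtain ⟨Ψ, cΨ, i1, i2⟩ := perturb g hg hl
  have hon : ∀ p i y, gd (b0 p i) y = 0 → y + g (p, y) = y + disp (b0 p i) (b1 p i) y := by
    intro p i y hy
    simp only [g]
    rw [Finset.sum_eq_single i]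
    · simp [cut, hy]
    · intro j _ hj
      have h1 := gm_le_gd (b0 p j) (b0 p i) y hy
      have h2 := hm p j i hj
      have : 1 ≤ gd (b0 p j) y / ε := by rw [le_div_iff₀ hε, one_mul]; linarith
      unfold cut
      rw [max_eq_left (by linarith), zero_smul]
    · simp
  have hmap : ∀ p i y, gd (b0 p i) y = 0 → gd (b1 p i) (y + g (p, y)) = 0 := by
    intro p i y hy
    rw [hon p i y hy]
    rw [gd_eq_zero] at hy ⊢
    have h0 : 0 < (b0 p i).2 := by linarith [hr p i]
    have e : y + disp (b0 p i) (b1 p i) y - (b1 p i).1 = ((b1 p i).2 / (b0 p i).2) • (y - (b0 p i).1) := by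
      unfold disp; module
    constructor
    · simp [disp, hy.1]
    · rw [e, norm_smul, hy.2, Real.norm_eq_abs, abs_of_pos (div_pos (hr1 p i) h0)]
      field_simp
  refine ⟨fun x => x.2 + g x, Ψ, by fun_prop, cΨ, i1, i2, ?_, ?_, ?_⟩
  · intro p y
    constructor
    · rintro ⟨i, hi⟩
      exact ⟨i, hmap p i y hi⟩
    · rintro ⟨i, hi⟩
      simp only at hi
      have h0 : 0 < (b0 p i).2 := by linarith [hr p i]
      have h1 := hr1 p i
      set z := y + g (p, y) with hz
      let y' : E3 := (b0 p i).1 + ((b0 p i).2 / (b1 p i).2) • (z - (b1 p i).1)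
      have hy' : gd (b0 p i) y' = 0 := by
        rw [gd_eq_zero] at hi ⊢
        constructor
        · simp [y', hi.1]
        · simp only [y', add_sub_cancel_left]
          rw [norm_smul, hi.2, Real.norm_eq_abs, abs_of_pos (div_pos h0 h1)]
          field_simp
      have e : y' + g (p, y') = z := by
        rw [hon p i y' hy']
        have : y' + disp (b0 p i) (b1 p i) y' = (b1 p i).1 + ((b1 p i).2 / (b0 p i).2) • (y' - (b0 p i).1) := by
          unfold disp; module
        rw [this]
        simp only [y', add_sub_cancel_left, smul_smul]
        rw [div_mul_div_cancel₀ h0.ne', div_self h1.ne']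
        simp
      have : y' = y := by
        rw [← i1 p y', e, hz, i1]
      rw [← this]; exact ⟨i, hy'⟩
  · intro p hp y
    simp only [g]
    rw [Finset.sum_eq_zero]
    · simp
    intro i _
    rw [hZ p hp]
    have : (b1 p i).2 ≠ 0 := (hr1 p i).ne'
    simp [disp, this]
  · intro p y hy
    simp only [g]
    rw [Finset.sum_eq_zero]
    · simp
    intro i _
    have : 1 ≤ gd (b0 p i) y / ε := by
      rw [le_div_iff₀ hε, one_mul]
      unfold gd
      have k1 := norm_sub_norm_le y (b0 p i).1
      have := hR p i
      have k2 := le_abs_self (‖y - (b0 p i).1‖ - (b0 p i).2)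
      linarith [abs_nonneg (y 0 - (b0 p i).1 0)]
    unfold cut
    rw [max_eq_left (by linarith), zero_smul]

lemma pos_lb {X : Type*} [TopologicalSpace X] [CompactSpace X] (f : X → ℝ) (hf : Continuous f)
    (h : ∀ x, 0 < f x) : ∃ ε > 0, ∀ x, ε ≤ f x := by
  rcases isEmpty_or_nonempty X with hX | hX
  · exact ⟨1, one_pos, fun x => hX.elim x⟩
  · obtain ⟨x, -, hx⟩ := isCompact_univ.exists_isMinOn Set.univ_nonempty hf.continuousOn
    exact ⟨f x, h x, fun y => hx (Set.mem_univ y)⟩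

lemma pos_lb_fin {X ι : Type*} [TopologicalSpace X] [CompactSpace X] [Finite ι] (f : ι → X → ℝ)
    (hf : ∀ i, Continuous (f i))
    (h : ∀ i x, 0 < f i x) : ∃ ε > 0, ∀ i x, ε ≤ f i x := by
  choose e he1 he2 using fun i => pos_lb (f i) (hf i) (h i)
  rcases isEmpty_or_nonempty ι with hι | hι
  · exact ⟨1, one_pos, fun i => hι.elim i⟩
  · obtain ⟨i, hi⟩ := Finite.exists_min e
    exact ⟨e i, he1 i, fun j x => (hi j).trans (he2 j x)⟩

lemma up_bd_fin {X ι : Type*} [TopologicalSpace X] [CompactSpace X] [Finite ι] (f : ι → X → ℝ)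
    (hf : ∀ i, Continuous (f i)) : ∃ R, 0 ≤ R ∧ ∀ i x, f i x ≤ R := by
  obtain ⟨ε, hε, h⟩ := pos_lb_fin (fun i x => Real.exp (-f i x)) (fun i => by have := hf i; fun_prop)
    (fun i x => Real.exp_pos _)
  refine ⟨max 0 (-Real.log ε), le_max_left _ _, fun i x => ?_⟩
  have := (Real.log_le_iff_le_exp hε).2 (h i x)
  refine le_trans ?_ (le_max_right _ _)
  linarith

lemma transport {n : ℕ} {P : Type*} [PseudoMetricSpace P] [CompactSpace P]
    (β : I × P → Fin n → E3 × ℝ) (hβ : Continuous β) (hv : ∀ x, Valid (β x))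
    (Z : Set P) (hZ : ∀ p ∈ Z, ∀ τ τ', β (τ, p) = β (τ', p)) (R : ℝ) (hR0 : 0 ≤ R)
    (hR : ∀ x i, ‖(β x i).1‖ + (β x i).2 + 1 ≤ R) :
    Tr Z R (fun p => β (0, p)) (fun p => β (1, p)) := by
  obtain ⟨ε1, hε1, h1⟩ := pos_lb_fin (fun i x => (β x i).2) (fun i => by fun_prop)
    (fun i x => (hv x).1 i)
  obtain ⟨ε2, hε2, h2⟩ := pos_lb_fin
    (fun (ij : {ij : Fin n × Fin n // ij.1 ≠ ij.2}) x => gm (β x ij.1.1) (β x ij.1.2))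
    (fun ij => gm_cont.comp (f := fun x => (β x ij.1.1, β x ij.1.2)) (by fun_prop))
    (fun ij x => (hv x).2 _ _ ij.2)
  obtain ⟨ε, hε, he1, he2, he3⟩ : ∃ ε > 0, ε ≤ ε1 ∧ ε ≤ ε2 ∧ ε ≤ 1 :=
    ⟨min ε1 (min ε2 1), by positivity, min_le_left _ _,
      (min_le_right _ _).trans (min_le_left _ _), (min_le_right _ _).trans (min_le_right _ _)⟩
  obtain ⟨η, hη, hsm⟩ : ∃ η > 0, n * (2 / ε * (η + η / ε * R) + η / ε) ≤ 1 / 2 := by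
    have hC : 0 ≤ n * (2 / ε * (1 + R / ε) + 1 / ε) := by positivity
    set C := n * (2 / ε * (1 + R / ε) + 1 / ε) with hCd
    refine ⟨1 / (2 * (C + 1)), by positivity, ?_⟩
    have : ∀ η : ℝ, n * (2 / ε * (η + η / ε * R) + η / ε) = η * C := by
      intro η; rw [hCd]; ring
    rw [this, div_mul_eq_mul_div, div_le_div_iff₀ (by positivity) (by positivity)]
    linarith
  have huc := CompactSpace.uniformContinuous_of_continuous hβ
  rw [Metric.uniformContinuous_iff] at huc
  obtain ⟨δ, hδ, hclose⟩ := huc η hη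
  obtain ⟨N, hN⟩ := exists_nat_one_div_lt hδ
  let τ : ℕ → I := fun k => Set.projIcc 0 1 zero_le_one ((k : ℝ) / (N + 1))
  have hτ : ∀ k, dist (τ (k + 1)) (τ k) < δ := by
    intro k
    refine lt_of_le_of_lt ?_ hN
    rw [Subtype.dist_eq, Real.dist_eq]
    refine (Set.abs_projIcc_sub_projIcc _).trans ?_
    rw [← sub_div]
    rw [abs_of_nonneg (by push_cast; simp; positivity)]
    push_cast; simp
  have main : ∀ k, Tr Z R (fun p => β (0, p)) (fun p => β (τ k, p)) := by
    intro k
    induction k with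
    | zero =>
      have : τ 0 = 0 := by simp [τ]
      rw [this]; exact Tr.refl _ _ _
    | succ k ih =>
      refine ih.trans ?_
      have hcl : ∀ p i, dist (β (τ (k+1), p) i) (β (τ k, p) i) ≤ η := by
        intro p i
        refine (dist_le_pi_dist _ _ i).trans (hclose ?_).le
        rw [Prod.dist_eq]
        simpa using hτ k
      refine small_step hε hη.le hsm _ _ (by fun_prop) (by fun_prop) ?_ ?_ ?_ ?_ ?_ ?_ ?_
      · intro p i; exact he1.trans (h1 i _)
      · intro p i; exact (hv _).1 i
      · intro p i; linarith [hR (τ k, p) i]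
      · intro p i j hij; exact he2.trans (h2 ⟨(i, j), hij⟩ _)
      · intro p i; rw [← dist_eq_norm]
        exact le_trans (le_max_left _ _) ((Prod.dist_eq (x := β (τ (k+1), p) i)).symm ▸ hcl p i)
      · intro p i; rw [← Real.dist_eq]
        exact le_trans (le_max_right _ _) ((Prod.dist_eq (x := β (τ (k+1), p) i)).symm ▸ hcl p i)
      · intro p hp; exact hZ p hp _ _
  have := main (N + 1)
  have h1 : τ (N + 1) = 1 := by
    simp only [τ]
    push_cast
    rw [div_self (by positivity)]
    exact Set.projIcc_right _
  rwa [h1] at this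

lemma gd_segment_avoid {n : ℕ} (b : Fin n → E3 × ℝ) (q : E3) (hq : q ∉ RingsOf b) (R : ℝ) :
    ∃ q', R ≤ ‖q'‖ ∧ JoinedIn (RingsOf b)ᶜ q q' := by
  have hop : IsOpen (RingsOf b)ᶜ := by
    have : (RingsOf b) = ⋃ i, {y | gd (b i) y = 0} := by ext; simp [RingsOf]
    rw [this, isOpen_compl_iff]
    refine isClosed_iUnion_of_finite fun i => isClosed_eq ?_ continuous_const
    exact gd_cont.comp (f := fun y => (b i, y)) (by fun_prop)
  obtain ⟨δ, hδ, hball⟩ := Metric.isOpen_iff.1 hop q hq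
  -- avoid finitely many planes
  obtain ⟨x', hx', hx2⟩ : ∃ x' ∈ Set.Ioo (q 0) (q 0 + δ), ∀ i, x' ≠ (b i).1 0 := by
    have hinf : (Set.Ioo (q 0) (q 0 + δ)).Infinite := Set.Ioo_infinite (by linarith)
    obtain ⟨x', h1, h2⟩ := (hinf.sdiff (Set.finite_range fun i => (b i).1 0)).nonempty
    exact ⟨x', h1, fun i h => h2 ⟨i, h.symm⟩⟩
  let q1 : E3 := q + (x' - q 0) • EuclideanSpace.single 0 1
  let q2 : E3 := q1 + (R - q1 1) • EuclideanSpace.single 1 1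
  have hq1 : q1 0 = x' := by simp [q1]
  have hq2 : q2 0 = x' := by simp [q2, hq1]
  refine ⟨q2, ?_, ?_⟩
  · have : q2 1 = R := by simp [q2]
    have h := coord_le q2 1
    rw [this] at h
    exact (le_abs_self R).trans h
  · refine JoinedIn.trans (y := q1) (JoinedIn.of_segment_subset ?_) (JoinedIn.of_segment_subset ?_)
    · refine Set.Subset.trans ?_ hball
      refine (convex_ball q δ).segment_subset (Metric.mem_ball_self hδ) ?_
      rw [Metric.mem_ball, dist_eq_norm]
      simp only [q1, add_sub_cancel_left, norm_smul]
      simp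
      rw [abs_of_pos (by linarith [hx'.1])]
      linarith [hx'.2]
    · intro y hy
      rintro ⟨i, hi⟩
      rw [gd_eq_zero] at hi
      apply hx2 i
      rw [← hi.1]
      obtain ⟨a, c, ha, hc, hac, rfl⟩ := hy
      simp [hq1, hq2]
      rw [← add_mul, hac, one_mul]

/-- first half of the interval -/
def lo (s : I) : I := Set.projIcc 0 1 zero_le_one (2 * (s : ℝ))
/-- second half of the interval -/
def hi (s : I) : I := Set.projIcc 0 1 zero_le_one (2 * (s : ℝ) - 1)
@[fun_prop] lemma lo_cont : Continuous lo := by unfold lo; exact continuous_projIcc.comp (by fun_prop)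
@[fun_prop] lemma hi_cont : Continuous hi := by unfold hi; exact continuous_projIcc.comp (by fun_prop)
lemma lo_zero : lo 0 = 0 := by simp [lo]
lemma hi_zero : hi 0 = 0 := by unfold hi; exact Set.projIcc_of_le_left _ (by simp)
lemma lo_one : lo 1 = 1 := by unfold lo; exact Set.projIcc_of_right_le _ (by simp)
lemma hi_one : hi 1 = 1 := by unfold hi; exact Set.projIcc_of_right_le _ (by norm_num)
lemma lo_hi (s : I) : lo s = 1 ∨ hi s = 0 := by
  rcases le_total (1 / 2 : ℝ) s with h | h
  · left; unfold lo; exact Set.projIcc_of_right_le _ (by linarith)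
  · right; unfold hi; exact Set.projIcc_of_le_left _ (by linarith)

lemma main_lift {n : ℕ} (K D : I × I → Fin n → E3 × ℝ) (q : I × I → E3)
    (b0 : Fin n → E3 × ℝ) (q0 : E3)
    (hK : Continuous K) (hD : Continuous D) (hq : Continuous q)
    (vK : ∀ x, Valid (K x)) (vD : ∀ x, Valid (D x)) (hqD : ∀ x, q x ∉ RingsOf (D x))
    (K0 : ∀ t, K (0, t) = b0) (Kl : ∀ s, K (s, 0) = b0) (Kr : ∀ s, K (s, 1) = b0)
    (D0 : ∀ t, D (0, t) = b0) (Dl : ∀ s, D (s, 0) = b0) (Dr : ∀ s, D (s, 1) = b0)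
    (Q0 : ∀ t, q (0, t) = q0) (Ql : ∀ s, q (s, 0) = q0) (Qr : ∀ s, q (s, 1) = q0)
    (KD : ∀ t, K (1, t) = D (1, t)) :
    ∃ w : I × I → E3, ∃ q' : E3, Continuous w ∧ (∀ x, w x ∉ RingsOf (K x)) ∧
      (∀ t, w (1, t) = q (1, t)) ∧ (∀ t, w (0, t) = q') ∧ (∀ s, w (s, 0) = w (s, 1)) := by
  obtain ⟨R1, hR1, hb1⟩ := up_bd_fin (fun i x => ‖(K x i).1‖ + (K x i).2 + 1) (fun i => by fun_prop)
  obtain ⟨R2, hR2, hb2⟩ := up_bd_fin (fun i x => ‖(D x i).1‖ + (D x i).2 + 1) (fun i => by fun_prop)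
  let R := max R1 R2
  have hR : 0 ≤ R := le_max_of_le_left hR1
  let Z : Set (I × I) := {x | x.1 = 0 ∨ x.2 = 0 ∨ x.2 = 1}
  have tK := transport (P := I × I) (fun x => K (x.1 * x.2.1, x.2.2)) (by fun_prop) (fun x => vK _) Z
    (by rintro ⟨s, t⟩ (h | h | h) τ τ' <;> simp only at h <;> subst h <;> simp [K0, Kl, Kr])
    R hR (fun x i => (hb1 i _).trans (le_max_left _ _))
  have tD := transport (P := I × I) (fun x => D (x.1 * x.2.1, x.2.2)) (by fun_prop) (fun x => vD _) Z
    (by rintro ⟨s, t⟩ (h | h | h) τ τ' <;> simp only at h <;> subst h <;> simp [D0, Dl, Dr])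
    R hR (fun x i => (hb2 i _).trans (le_max_right _ _))
  simp only [zero_mul, one_mul, K0, D0] at tK tD
  obtain ⟨Φ, Ψ, c1, c2, i1, i2, r, z, f⟩ := tK
  obtain ⟨Φ', Ψ', c1', c2', i1', i2', r', z', f'⟩ := tD
  have hq0 : q0 ∉ RingsOf b0 := by have := hqD (0, 0); rwa [Q0, D0] at this
  obtain ⟨q1, hq1, ω, hω⟩ := gd_segment_avoid b0 q0 hq0 R
  let u : I × I → E3 := fun x => Ψ' (x, q x)
  have hu : Continuous u := by fun_prop
  have hub : ∀ x, u x ∉ RingsOf b0 := by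
    intro x
    rw [r' x (u x)]
    simp only [u]
    rw [i2']
    exact hqD x
  have zz : ∀ p ∈ Z, ∀ y, Ψ (p, y) = y := by
    intro p hp y
    have := z p hp (Ψ (p, y)); rw [i2] at this; exact this.symm
  have zz' : ∀ p ∈ Z, ∀ y, Ψ' (p, y) = y := by
    intro p hp y
    have := z' p hp (Ψ' (p, y)); rw [i2'] at this; exact this.symm
  let ψ : I × E3 → E3 := fun x => Ψ ((1, x.1), Φ' ((1, x.1), x.2))
  have hψ : Continuous ψ := by fun_prop
  have hψb : ∀ t y, y ∉ RingsOf b0 → ψ (t, y) ∉ RingsOf b0 := by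
    intro t y hy
    rw [r (1, t)]
    simp only [ψ]
    rw [i2, KD, ← r' (1, t)]
    exact hy
  have hψ1 : ∀ t, ψ (t, q1) = q1 := by
    intro t
    simp only [ψ]
    rw [f' _ _ hq1]
    have := f (1, t) q1 hq1
    nth_rewrite 1 [← this]
    rw [i1]
  have hψZ : ∀ t y, (t = 0 ∨ t = 1) → ψ (t, y) = y := by
    intro t y ht
    simp only [ψ]
    have : ((1 : I), t) ∈ Z := Or.inr ht
    rw [z' _ this, zz _ this]
  let v : I × I → E3 := fun x => ω.symm (lo x.1) + u (hi x.1, x.2) - q0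
  have hv : Continuous v := by fun_prop
  have u0 : ∀ t, u (0, t) = q0 := by
    intro t; simp only [u]; rw [zz' _ (Or.inl rfl), Q0]
  have ul : ∀ s, u (s, 0) = q0 := by
    intro t; simp only [u]; rw [zz' _ (Or.inr (Or.inl rfl)), Ql]
  have ur : ∀ s, u (s, 1) = q0 := by
    intro t; simp only [u]; rw [zz' _ (Or.inr (Or.inr rfl)), Qr]
  have hvb : ∀ x, v x ∉ RingsOf b0 := by
    rintro ⟨s, t⟩
    simp only [v]
    rcases lo_hi s with h | h
    · rw [h]
      simp only [Path.target, add_sub_cancel_left]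
      exact hub _
    · rw [h, u0, add_sub_cancel_right]
      exact hω _
  refine ⟨fun x => Φ (x, ψ (x.2, v x)), q1, by fun_prop, ?_, ?_, ?_, ?_⟩
  · intro x
    rw [← r x]
    exact hψb _ _ (hvb x)
  · intro t
    have : v (1, t) = u (1, t) := by simp [v, lo_one, hi_one]
    simp only [this, ψ, i2]
    simp only [u, i2']
  · intro t
    have : v (0, t) = q1 := by simp [v, lo_zero, hi_zero, u0]
    simp only [this, hψ1]
    exact z _ (Or.inl rfl) _
  · intro s
    simp only
    rw [z _ (Or.inr (Or.inl rfl)), z _ (Or.inr (Or.inr rfl)), hψZ _ _ (Or.inl rfl),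
      hψZ _ _ (Or.inr rfl)]
    simp [v, ul, ur]

lemma free_null {X : Type*} [TopologicalSpace X] {x y : X} (γ : Path x x) (H : I × I → X)
    (hH : Continuous H) (h1 : ∀ t, H (1, t) = γ t) (h0 : ∀ t, H (0, t) = y)
    (hs : ∀ s, H (s, 0) = H (s, 1)) : γ.Homotopic (Path.refl x) := by
  have : SimplyConnectedSpace (I × I) := by
    have : ContractibleSpace I := (convex_Icc (0:ℝ) 1).contractibleSpace ⟨0, by simp⟩
    infer_instance
  let top : Path ((1 : I), (0 : I)) (1, 1) := ⟨⟨fun t => (1, t), by fun_prop⟩, rfl, rfl⟩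
  let a : Path ((1 : I), (0 : I)) (0, 0) := ⟨⟨fun t => (σ t, 0), by fun_prop⟩, by simp, by simp⟩
  let b : Path ((0 : I), (0 : I)) (0, 1) := ⟨⟨fun t => (0, t), by fun_prop⟩, rfl, rfl⟩
  let c : Path ((0 : I), (1 : I)) (1, 1) := ⟨⟨fun t => (t, 1), by fun_prop⟩, rfl, rfl⟩
  have hom : top.Homotopic ((a.trans b).trans c) := SimplyConnectedSpace.paths_homotopic _ _
  have hom2 := hom.map ⟨H, hH⟩
  have e0 : x = H (1, 0) := by rw [h1]; simp
  have e1 : x = H (1, 1) := by rw [h1]; simp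
  have hom3 := hom2.pathCast e0 e1
  let a' : Path x y := ⟨⟨fun t => H (σ t, 0), by fun_prop⟩, by simp [h1], by simp [h0]⟩
  have k1 : γ = (top.map hH).cast e0 e1 := by
    ext t; simp [top, h1]
  have k2 : (a'.trans (Path.refl y)).trans a'.symm = (((a.trans b).trans c).map hH).cast e0 e1 := by
    ext t
    simp only [Path.trans_apply, Path.cast_coe, Path.map_coe, Function.comp]
    split_ifs
    · rfl
    · exact (h0 _).symm
    · simp [a', Path.symm, c, hs]
  have hom4 : γ.Homotopic ((a'.trans (Path.refl y)).trans a'.symm) := by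
    rw [k1, k2]; exact hom3
  refine hom4.trans ?_
  refine Path.Homotopic.trans (Path.Homotopic.hcomp (Path.Homotopic.trans_refl a') (Path.Homotopic.refl _)) ?_
  exact Path.Homotopic.trans_symm a'

abbrev BC (n : ℕ) : Type := {b : Fin n → E3 × ℝ // Valid b}
abbrev AC (n : ℕ) : Type := {b : Fin n → E3 × ℝ // Valid b ∧ StrictMono fun i => (b i).2}

def inclAB (n : ℕ) : C(AC n, BC n) := ⟨fun b => ⟨b.1, b.2.1⟩, by fun_prop⟩

lemma Valid.tail {n : ℕ} {b : Fin (n+1) → E3 × ℝ} (h : Valid b) : Valid fun i : Fin n => b i.succ :=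
  ⟨fun i => h.1 _, fun i j hij => h.2 _ _ (by simpa using hij)⟩

def tailB (n : ℕ) : C(BC (n+1), BC n) :=
  ⟨fun b => ⟨fun i => b.1 i.succ, b.2.tail⟩,
    Continuous.subtype_mk (continuous_pi fun i => (continuous_apply i.succ).comp continuous_subtype_val) _⟩

def tailA (n : ℕ) : C(AC (n+1), AC n) :=
  ⟨fun b => ⟨fun i => b.1 i.succ, b.2.1.tail, fun i j hij => b.2.2 (by simpa using hij)⟩,
    Continuous.subtype_mk (continuous_pi fun i => (continuous_apply i.succ).comp continuous_subtype_val) _⟩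

/-- the unit vector in the second coordinate direction -/
def ee : E3 := EuclideanSpace.single 1 1
lemma ee_norm : ‖ee‖ = 1 := by simp [ee]
lemma ee_zero : ee 0 = 0 := by simp [ee]

lemma gm_symm (p q : E3 × ℝ) : gm p q = gm q p := by
  unfold gm
  rw [abs_sub_comm, norm_sub_rev, abs_sub_comm p.2, sub_right_comm]

/-- shrinking the smaller ring -/
lemma gm_shrink (p q : E3 × ℝ) (hpq : p.2 ≤ q.2) (ρ : ℝ) (h1 : ρ ≤ p.2) :
    gm p q ≤ gm (p.1 + p.2 • ee - ρ • ee, ρ) q := by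
  unfold gm
  have e : (p.1 + p.2 • ee - ρ • ee) 0 = p.1 0 := by simp [ee_zero]
  rw [e]
  have e2 : p.1 + p.2 • ee - ρ • ee - q.1 = (p.1 - q.1) + (p.2 - ρ) • ee := by module
  have n1 : ‖(p.2 - ρ) • ee‖ = p.2 - ρ := by
    rw [norm_smul, ee_norm, Real.norm_eq_abs, abs_of_nonneg (by linarith), mul_one]
  have n2 := norm_add_le (p.1 - q.1) ((p.2 - ρ) • ee)
  have n3 := norm_sub_le_norm_add (p.1 - q.1) ((p.2 - ρ) • ee)
  rw [n1, ← e2] at n2 n3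
  rw [abs_of_nonpos (show p.2 - q.2 ≤ 0 by linarith), abs_of_nonpos (show ρ - q.2 ≤ 0 by linarith)]
  have k1 : ‖p.1 - q.1‖ - p.2 - q.2 ≤ ‖p.1 + p.2 • ee - ρ • ee - q.1‖ - ρ - q.2 := by linarith
  have k2 : -(p.2 - q.2) - ‖p.1 - q.1‖ ≤ -(ρ - q.2) - ‖p.1 + p.2 • ee - ρ • ee - q.1‖ := by linarith
  exact add_le_add le_rfl (max_le_max le_rfl (max_le_max k1 k2))

/-- tiny rings -/
lemma gm_tiny (w : E3) (q : E3 × ℝ) (ε : ℝ) (hε : 0 < ε) (h : 2 * ε < gd q w) :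
    0 < gm (w - ε • ee, ε) q := by
  unfold gd at h
  unfold gm
  have e : (w - ε • ee) 0 = w 0 := by simp [ee_zero]
  rw [e]
  have n1 : ‖ε • ee‖ = ε := by
    rw [norm_smul, ee_norm, Real.norm_eq_abs, abs_of_pos hε, mul_one]
  have e2 : w - ε • ee - q.1 = (w - q.1) - ε • ee := by module
  have n2 := norm_sub_le (w - q.1) (ε • ee)
  have n3 := norm_sub_norm_le (w - q.1) (ε • ee)
  rw [n1, ← e2] at n2 n3
  have m1 := le_max_right 0 (max (‖w - ε • ee - q.1‖ - ε - q.2) (|ε - q.2| - ‖w - ε • ee - q.1‖))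
  have m2 := le_max_left (‖w - ε • ee - q.1‖ - ε - q.2) (|ε - q.2| - ‖w - ε • ee - q.1‖)
  have m3 := le_max_right (‖w - ε • ee - q.1‖ - ε - q.2) (|ε - q.2| - ‖w - ε • ee - q.1‖)
  have m4 := neg_abs_le (ε - q.2)
  simp only
  rcases abs_cases (‖w - q.1‖ - q.2) with h' | h' <;> linarith

lemma valid_cons {n : ℕ} (p : E3 × ℝ) (b : Fin n → E3 × ℝ) (hp : 0 < p.2) (hb : Valid b)
    (h : ∀ i, 0 < gm p (b i)) : Valid (Fin.cons p b : Fin (n+1) → E3 × ℝ) := by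
  refine ⟨fun i => ?_, fun i j hij => ?_⟩
  · refine Fin.cases ?_ (fun i => ?_) i
    · simpa using hp
    · simpa using hb.1 i
  · revert hij
    refine Fin.cases ?_ (fun i => ?_) i <;> refine Fin.cases ?_ (fun j => ?_) j
    · simp
    · intro _; simpa using h j
    · intro _; rw [gm_symm]; simpa using h i
    · intro hij; simpa using hb.2 i j (by simpa using hij)

lemma mono_cons {n : ℕ} (p : E3 × ℝ) (b : Fin n → E3 × ℝ) (hb : StrictMono fun i => (b i).2)
    (h : ∀ i, p.2 < (b i).2) : StrictMono fun i => ((Fin.cons p b : Fin (n+1) → E3 × ℝ) i).2 := by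
  intro i j
  refine Fin.cases ?_ (fun i => ?_) i <;> refine Fin.cases ?_ (fun j => ?_) j
  · simp
  · intro _; simpa using h j
  · intro hij; simp at hij
  · intro hij; simpa using hb (by simpa using hij)

theorem injAB : ∀ (n : ℕ) (x : AC n) (γ : Path x x),
    (γ.map (inclAB n).continuous).Homotopic (Path.refl _) → γ.Homotopic (Path.refl x) := by
  intro n
  induction n with
  | zero =>
    intro x γ _
    have : γ = Path.refl x := by exact Path.ext (funext fun t => Subtype.ext (funext fun i => Fin.elim0 i))
    rw [this]
  | succ n ih =>
    intro x γ hγ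
    have hγ' := ih _ (γ.map (tailA n).continuous) (hγ.map (tailB n))
    obtain ⟨Kh⟩ := hγ'.symm
    obtain ⟨Dh⟩ := hγ.symm
    obtain ⟨K, hK⟩ : ∃ K : I × I → Fin n → E3 × ℝ, ∀ z, K z = (Kh z).1 := ⟨_, fun _ => rfl⟩
    obtain ⟨D, hD⟩ : ∃ D : I × I → Fin (n+1) → E3 × ℝ, ∀ z, D z = (Dh z).1 := ⟨_, fun _ => rfl⟩
    obtain ⟨g, hg⟩ : ∃ g : I → Fin (n+1) → E3 × ℝ, ∀ z, g z = (γ z).1 := ⟨_, fun _ => rfl⟩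
    have cK : Continuous K := by
      rw [funext hK]; exact continuous_subtype_val.comp Kh.continuous
    have cD : Continuous D := by
      rw [funext hD]; exact continuous_subtype_val.comp Dh.continuous
    have cg : Continuous g := by
      rw [funext hg]; exact continuous_subtype_val.comp γ.continuous
    have vK : ∀ z, Valid (K z) := fun z => by rw [hK]; exact (Kh z).2.1
    have mK : ∀ z, StrictMono fun i => (K z i).2 := fun z => by rw [hK]; exact (Kh z).2.2
    have vD : ∀ z, Valid (D z) := fun z => by rw [hD]; exact (Dh z).2
    have vg : ∀ z, Valid (g z) := fun z => by rw [hg]; exact (γ z).2.1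
    have mg : ∀ z, StrictMono fun i => (g z i).2 := fun z => by rw [hg]; exact (γ z).2.2
    have hD0 : ∀ t, D (0, t) = x.1 := fun t => by
      rw [hD]; exact congrArg Subtype.val (Dh.apply_zero t)
    have hD1 : ∀ t, D (1, t) = g t := fun t => by
      rw [hD, hg]; exact congrArg Subtype.val (Dh.apply_one t)
    have hDl : ∀ s, D (s, 0) = x.1 := fun t => by
      rw [hD]; exact congrArg Subtype.val (Dh.source t)
    have hDr : ∀ s, D (s, 1) = x.1 := fun t => by
      rw [hD]; exact congrArg Subtype.val (Dh.target t)
    have hK0 : ∀ t, K (0, t) = fun i => x.1 i.succ := fun t => by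
      rw [hK]; exact congrArg Subtype.val (Kh.apply_zero t)
    have hK1 : ∀ t, K (1, t) = fun i => g t i.succ := fun t => by
      rw [hK, hg]; exact congrArg Subtype.val (Kh.apply_one t)
    have hKl : ∀ s, K (s, 0) = fun i => x.1 i.succ := fun t => by
      rw [hK]; exact congrArg Subtype.val (Kh.source t)
    have hKr : ∀ s, K (s, 1) = fun i => x.1 i.succ := fun t => by
      rw [hK]; exact congrArg Subtype.val (Kh.target t)
    have g0 : g 0 = x.1 := by rw [hg]; simp
    have g1 : g 1 = x.1 := by rw [hg]; simp
    obtain ⟨w, q', cw, hwK, hw1, hw0, hwlr⟩ := main_lift K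
      (fun z i => D z i.succ)
      (fun z => (D z 0).1 + (D z 0).2 • ee) (fun i => x.1 i.succ)
      ((x.1 0).1 + (x.1 0).2 • ee) cK (by fun_prop) (by fun_prop) vK
      (fun z => (vD z).tail)
      (by
        rintro z ⟨i, hi⟩
        have h1 : gd (D z 0) ((D z 0).1 + (D z 0).2 • ee) = 0 := by
          rw [gd_eq_zero]
          refine ⟨by simp [ee_zero], ?_⟩
          rw [add_sub_cancel_left, norm_smul, ee_norm, mul_one, Real.norm_eq_abs,
            abs_of_pos ((vD z).1 0)]
        have h2 := gm_le_gd (D z i.succ) _ _ h1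
        have h3 := (vD z).2 i.succ 0 (Fin.succ_ne_zero i)
        linarith)
      hK0 hKl hKr (by simp [hD0]) (by simp [hDl]) (by simp [hDr])
      (by simp [hD0]) (by simp [hDl]) (by simp [hDr]) (by simp [hD1, hK1])
    -- choose the size of the tiny ring
    obtain ⟨ε1, hε1, h1⟩ := pos_lb_fin (fun i z => gd (K z i) (w z))
      (fun i => gd_cont.comp (f := fun z => (K z i, w z)) (by fun_prop))
      (fun i z => lt_of_le_of_ne (gd_nonneg _ _) fun h => hwK z ⟨i, h.symm⟩)
    obtain ⟨ε2, hε2, h2⟩ := pos_lb_fin (fun i z => (K z i).2) (fun i => by fun_prop)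
      (fun i z => (vK z).1 i)
    obtain ⟨ε3, hε3, h3⟩ := pos_lb (fun t => (g t 0).2) (by fun_prop)
      (fun t => (vg t).1 0)
    obtain ⟨ε, hε, he1, he2, he3⟩ : ∃ ε > 0, 2 * ε < ε1 ∧ ε < ε2 ∧ ε ≤ ε3 := by
      refine ⟨min (ε1 / 3) (min (ε2 / 2) ε3), by positivity, ?_, ?_, ?_⟩
      · linarith [min_le_left (ε1 / 3) (min (ε2 / 2) ε3)]
      · linarith [min_le_right (ε1 / 3) (min (ε2 / 2) ε3), min_le_left (ε2 / 2) ε3]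
      · linarith [min_le_right (ε1 / 3) (min (ε2 / 2) ε3), min_le_right (ε2 / 2) ε3]
    let ρ : I × I → ℝ := fun z => ε + (hi z.1 : ℝ) * ((g z.2 0).2 - ε)
    have cρ : Continuous ρ := by fun_prop
    let H : I × I → Fin (n+1) → E3 × ℝ := fun z =>
      Fin.cons (w (lo z.1, z.2) - ρ z • ee, ρ z) (K (lo z.1, z.2))
    have cH : Continuous H := by
      refine continuous_pi fun i => ?_
      refine Fin.cases ?_ (fun i => ?_) i
      · simp only [H, Fin.cons_zero]; fun_prop
      · simp only [H, Fin.cons_succ]; fun_prop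
    have hval : ∀ z, Valid (H z) ∧ StrictMono fun i => (H z i).2 := by
      rintro ⟨s, t⟩
      rcases lo_hi s with h | h
      · have hwl : w (lo s, t) = (g t 0).1 + (g t 0).2 • ee := by rw [h, hw1, hD1]
        have hr3 := h3 t
        have hρ1 : ρ (s, t) ≤ (g t 0).2 := by
          simp only [ρ]
          nlinarith [(hi s).2.2]
        have hρ0 : 0 < ρ (s, t) := by
          simp only [ρ]
          have := mul_nonneg (hi s).2.1 (show 0 ≤ (g t 0).2 - ε by linarith)
          linarith
        have hlt : ∀ i : Fin n, (g t 0).2 < (g t i.succ).2 := fun i =>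
          mg t (Fin.succ_pos i)
        simp only [H]
        refine ⟨valid_cons _ _ hρ0 (vK _) ?_, mono_cons _ _ (mK _) ?_⟩
        · intro i
          rw [hwl, h, hK1]
          exact lt_of_lt_of_le ((vg t).2 0 i.succ (Fin.succ_ne_zero i).symm)
            (gm_shrink _ _ (hlt i).le _ hρ1)
        · intro i
          rw [h, hK1]
          exact lt_of_le_of_lt hρ1 (hlt i)
      · have hρ : ρ (s, t) = ε := by simp [ρ, h]
        simp only [H]
        refine ⟨valid_cons _ _ ?_ (vK _) ?_, mono_cons _ _ (mK _) ?_⟩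
        · simpa [hρ] using hε
        · intro i
          rw [hρ]
          exact gm_tiny _ _ _ hε (lt_of_lt_of_le he1 (h1 i _))
        · intro i
          rw [hρ]
          exact lt_of_lt_of_le he2 (h2 i _)
    refine free_null γ (fun z => (⟨H z, hval z⟩ : AC (n+1)))
      (y := ⟨H (0, 0), hval _⟩) (by fun_prop) ?_ ?_ ?_
    · intro t
      apply Subtype.ext
      simp only [H, lo_one, hw1, hK1, hD1, ρ, hi_one, ← hg]
      funext i
      refine Fin.cases ?_ (fun i => ?_) i
      · ext <;> simp
      · simp
    · intro t
      apply Subtype.ext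
      simp only [H, lo_zero, hw0, hK0, ρ, hi_zero]
      simp
    · intro s
      apply Subtype.ext
      simp only [H, hwlr, hKl, hKr, ρ, g0, g1]

lemma E3_norm_eq (x : E3) (r : ℝ) (hr : 0 ≤ r) : ‖x‖ = r ↔ x 0 ^ 2 + x 1 ^ 2 + x 2 ^ 2 = r ^ 2 := by
  rw [← sq_eq_sq₀ (norm_nonneg _) hr, EuclideanSpace.real_norm_sq_eq, Fin.sum_univ_three]

lemma E3_inner (x w : E3) : inner ℝ x w = x 0 * w 0 + x 1 * w 1 + x 2 * w 2 := by
  rw [PiLp.inner_apply, Fin.sum_univ_three]; simp; ring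

lemma exists_perp (w : E3) : ∃ u : E3, ‖u‖ = 1 ∧ inner ℝ u w = (0 : ℝ) := by
  have : ∃ u : E3, u ≠ 0 ∧ inner ℝ u w = (0 : ℝ) := by
    by_cases h : w 0 = 0
    · exact ⟨EuclideanSpace.single 0 1, by simp, by rw [E3_inner]; simp [h]⟩
    · refine ⟨!₂[- w 1, w 0, 0], fun h' => h ?_, by rw [E3_inner]; simp; ring⟩
      have := congrArg (fun v : E3 => v 1) h'
      simpa using this
  obtain ⟨u, hu, h⟩ := this
  refine ⟨(‖u‖⁻¹ : ℝ) • u, ?_, by rw [inner_smul_left, h, mul_zero]⟩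
  rw [norm_smul, norm_inv, norm_norm, inv_mul_cancel₀ (norm_ne_zero_iff.2 hu)]

lemma mem_pCircle (p : E3 × E3) (x : E3) :
    x ∈ pCircle p ↔ ‖x - p.1‖ = ‖p.2‖ ∧ inner ℝ (x - p.1) p.2 = (0 : ℝ) := Iff.rfl
lemma mem_pDisk (p : E3 × E3) (x : E3) :
    x ∈ pDisk p ↔ ‖x - p.1‖ ≤ ‖p.2‖ ∧ inner ℝ (x - p.1) p.2 = (0 : ℝ) := Iff.rfl

lemma pCircle_nonempty (p : E3 × E3) : (pCircle p).Nonempty := by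
  obtain ⟨u, hu, h⟩ := exists_perp p.2
  refine ⟨p.1 + ‖p.2‖ • u, ?_⟩
  rw [mem_pCircle, add_sub_cancel_left, norm_smul, hu, norm_norm, inner_smul_left, h]
  simp

lemma unit_cases (e : ℤˣ) : ((e : ℤ) : ℝ) = 1 ∨ ((e : ℤ) : ℝ) = -1 := by
  rcases Int.units_eq_one_or e with h | h <;> simp [h]

/-- change the sign of the normal vector -/
def sgn (e : ℤˣ) (p : E3 × E3) : E3 × E3 := (p.1, ((e : ℤ) : ℝ) • p.2)

lemma sgn_norm (e : ℤˣ) (p : E3 × E3) : ‖(sgn e p).2‖ = ‖p.2‖ := by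
  rcases unit_cases e with h | h <;> simp [sgn, h]

lemma pCircle_sgn (e : ℤˣ) (p : E3 × E3) : pCircle (sgn e p) = pCircle p := by
  ext x
  rw [mem_pCircle, mem_pCircle, sgn_norm]
  rcases unit_cases e with h | h <;> simp [sgn, h]

lemma pDisk_sgn (e : ℤˣ) (p : E3 × E3) : pDisk (sgn e p) = pDisk p := by
  ext x
  rw [mem_pDisk, mem_pDisk, sgn_norm]
  rcases unit_cases e with h | h <;> simp [sgn, h]

lemma pCircle_center (p q : E3 × E3) (h : pCircle p = pCircle q) : p.1 = q.1 := by
  obtain ⟨x, hx⟩ := pCircle_nonempty p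
  have refl : ∀ (r : E3 × E3) y, y ∈ pCircle r → r.1 + r.1 - y ∈ pCircle r := by
    intro r y hy
    rw [mem_pCircle] at hy ⊢
    have : r.1 + r.1 - y - r.1 = - (y - r.1) := by abel
    rw [this, norm_neg, inner_neg_left, hy.1, hy.2]; simp
  have h1 := refl p _ (h ▸ refl q x (h ▸ hx))
  have h2 := h ▸ refl q _ (h ▸ refl p x hx)
  have e1 : p.1 + p.1 - (q.1 + q.1 - x) - p.1 = (x - p.1) + (2 : ℝ) • (p.1 - q.1) := by module
  have e2 : q.1 + q.1 - (p.1 + p.1 - x) - p.1 = (x - p.1) - (2 : ℝ) • (p.1 - q.1) := by module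
  rw [mem_pCircle] at h1 h2 hx
  rw [e1] at h1
  rw [e2] at h2
  have := parallelogram_law_with_norm ℝ (x - p.1) ((2 : ℝ) • (p.1 - q.1))
  rw [h1.1, h2.1, hx.1] at this
  have h0 : ‖(2 : ℝ) • (p.1 - q.1)‖ = 0 := by nlinarith
  simpa [sub_eq_zero] using h0

lemma pCircle_eq (p q : E3 × E3) (hp : p.2 ≠ 0) (h : pCircle p = pCircle q) :
    ∃ e : ℤˣ, q = sgn e p := by
  have hc := pCircle_center p q h
  have hr : ‖p.2‖ = ‖q.2‖ := by
    obtain ⟨x, hx⟩ := pCircle_nonempty p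
    have hx' := h ▸ hx
    rw [mem_pCircle] at hx hx'
    rw [← hx.1, ← hx'.1, hc]
  have hspan : q.2 ∈ Submodule.span ℝ {p.2} := by
    rw [← Submodule.orthogonal_orthogonal (Submodule.span ℝ {p.2})]
    rw [Submodule.mem_orthogonal]
    intro u hu
    rw [Submodule.mem_orthogonal_singleton_iff_inner_left] at hu
    by_cases hu0 : u = 0
    · simp [hu0]
    have hn : ‖u‖ ≠ 0 := norm_ne_zero_iff.2 hu0
    have : p.1 + (‖p.2‖ * ‖u‖⁻¹) • u ∈ pCircle p := by
      rw [mem_pCircle, add_sub_cancel_left, inner_smul_left, hu, norm_smul]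
      simp [hn]
    rw [h, mem_pCircle, ← hc, add_sub_cancel_left, inner_smul_left] at this
    have h3 := this.2
    have : ‖p.2‖ ≠ 0 := norm_ne_zero_iff.2 hp
    simpa [this, hn] using h3
  obtain ⟨a, ha⟩ := Submodule.mem_span_singleton.1 hspan
  have ha1 : |a| = 1 := by
    rw [← ha, norm_smul, Real.norm_eq_abs] at hr
    have : ‖p.2‖ ≠ 0 := norm_ne_zero_iff.2 hp
    field_simp at hr
    exact hr.symm
  rcases eq_or_eq_neg_of_abs_eq ha1 with h' | h'
  · exact ⟨1, Prod.ext hc.symm (by rw [← ha, h']; simp [sgn])⟩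
  · exact ⟨-1, Prod.ext hc.symm (by rw [← ha, h']; simp [sgn])⟩

lemma ring_act {n : ℕ} (f : Fin n → E3 × E3) (hf : IsRingTuple f) (τ : Equiv.Perm (Fin n))
    (e : Fin n → ℤˣ) : IsRingTuple fun i => sgn (e i) (f (τ i)) := by
  refine ⟨fun i => ?_, fun i j hij => ?_, fun i j hij => ?_⟩
  · rw [← norm_ne_zero_iff, sgn_norm, norm_ne_zero_iff]; exact hf.1 _
  · rw [pCircle_sgn, pCircle_sgn]; exact hf.2.1 _ _ (by simpa using hij)
  · have := hf.2.2 (τ i) (τ j) (by simpa using hij)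
    unfold UnlinkedPair LinksOnce at this ⊢
    rw [pCircle_sgn, pCircle_sgn, pDisk_sgn, pDisk_sgn]; exact this

/-- relabel and flip normals -/
def act {n : ℕ} (τ : Equiv.Perm (Fin n)) (e : Fin n → ℤˣ) (f : RingTuple n) : RingTuple n :=
  ⟨fun i => sgn (e i) (f.1 (τ i)), ring_act f.1 f.2 τ e⟩

lemma act_cont {n : ℕ} (τ : Equiv.Perm (Fin n)) (e : Fin n → ℤˣ) : Continuous (act τ e) := by
  refine Continuous.subtype_mk (continuous_pi fun i => ?_) _
  have : Continuous fun f : RingTuple n => f.1 (τ i) :=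
    (continuous_apply _).comp continuous_subtype_val
  have c : Continuous fun p : E3 × E3 => sgn (e i) p := by unfold sgn; fun_prop
  exact c.comp this

lemma mk_act {n : ℕ} (τ : Equiv.Perm (Fin n)) (e : Fin n → ℤˣ) (f : RingTuple n) :
    Quotient.mk (ringSetoid n) (act τ e f) = Quotient.mk (ringSetoid n) f := by
  apply Quotient.sound
  show Set.range _ = Set.range _
  simp only [act, pCircle_sgn]
  exact τ.surjective.range_comp (fun i => pCircle (f.1 i))

lemma circ_inj {n : ℕ} (f : RingTuple n) : Function.Injective fun i => pCircle (f.1 i) := by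
  intro i j hij
  by_contra h
  have := f.2.2.1 i j h
  simp only at hij
  rw [hij, disjoint_self] at this
  exact (pCircle_nonempty _).ne_empty this

lemma mk_eq {n : ℕ} (f g : RingTuple n)
    (h : Quotient.mk (ringSetoid n) f = Quotient.mk (ringSetoid n) g) :
    ∃ τ e, g = act τ e f := by
  have h : (Set.range fun i => pCircle (f.1 i)) = Set.range fun i => pCircle (g.1 i) :=
    Quotient.exact h
  have h1 : ∀ i, ∃ j, pCircle (f.1 j) = pCircle (g.1 i) := by
    intro i
    have : pCircle (g.1 i) ∈ Set.range fun i => pCircle (f.1 i) := by rw [h]; exact ⟨i, rfl⟩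
    exact this
  choose t ht using h1
  have tinj : Function.Injective t := by
    intro i j hij
    apply circ_inj g
    simp only
    rw [← ht, ← ht, hij]
  choose e he using fun i => pCircle_eq _ _ (f.2.1 (t i)) (ht i)
  refine ⟨Equiv.ofBijective t (Finite.injective_iff_bijective.1 tinj), e, ?_⟩
  exact Subtype.ext (funext he)

lemma mk_open (n : ℕ) : IsOpenMap (Quotient.mk (ringSetoid n)) := by
  intro U hU
  rw [← isQuotientMap_quotient_mk'.isOpen_preimage]
  have : (Quotient.mk (ringSetoid n)) ⁻¹' (Quotient.mk (ringSetoid n) '' U)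
      = ⋃ τ, ⋃ e, act τ e ⁻¹' U := by
    ext f
    simp only [Set.mem_preimage, Set.mem_image, Set.mem_iUnion]
    constructor
    · rintro ⟨g, hg, h⟩
      obtain ⟨τ, e, rfl⟩ := mk_eq _ _ h.symm
      exact ⟨τ, e, hg⟩
    · rintro ⟨τ, e, h⟩
      exact ⟨_, h, mk_act _ _ _⟩
  erw [this]
  exact isOpen_iUnion fun τ => isOpen_iUnion fun e => hU.preimage (act_cont τ e)

/-- sorted positive tuples -/
def IsSorted {n : ℕ} (f : RingTuple n) : Prop :=
  StrictMono (fun i => ‖(f.1 i).2‖) ∧ ∀ i, 0 < (f.1 i).2 0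

abbrev SortedT (n : ℕ) : Type := {f : PURTuple n // IsSorted f.1}

lemma isSorted_open (n : ℕ) : IsOpen {f : RingTuple n | IsSorted f} := by
  have c : ∀ i, Continuous fun f : RingTuple n => (f.1 i).2 := fun i =>
    ((continuous_apply i).comp continuous_subtype_val).snd
  have c0 : ∀ i, Continuous fun f : RingTuple n => (f.1 i).2 0 := fun i => by
    have := c i
    fun_prop
  have e : {f : RingTuple n | IsSorted f} =
      (⋂ i, ⋂ j, ⋂ (_ : i < j), {f : RingTuple n | ‖(f.1 i).2‖ < ‖(f.1 j).2‖}) ∩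
      ⋂ i, {f : RingTuple n | 0 < (f.1 i).2 0} := by
    ext f
    simp only [IsSorted, StrictMono, Set.mem_ofPred_eq, Set.mem_inter_iff, Set.mem_iInter]
  rw [e]
  refine IsOpen.inter ?_ ?_
  · exact isOpen_iInter_of_finite fun i => isOpen_iInter_of_finite fun j =>
      isOpen_iInter_of_finite fun _ => isOpen_lt (c i).norm (c j).norm
  · exact isOpen_iInter_of_finite fun i => isOpen_lt continuous_const (c0 i)

lemma untw_act {n : ℕ} (τ : Equiv.Perm (Fin n)) (e : Fin n → ℤˣ) (f : RingTuple n)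
    (hf : IsUntwistedTuple f) : IsUntwistedTuple (act τ e f) := by
  intro i
  have := hf (τ i)
  simp [act, sgn, this.1, this.2]

def GG (n : ℕ) (f : SortedT n) : ↥(URlt n) :=
  ⟨Quotient.mk (ringSetoid n) f.1.1, f.1.1, rfl, f.1.2, f.2.1.injective⟩

lemma GG_cont (n : ℕ) : Continuous (GG n) :=
  Continuous.subtype_mk (continuous_quotient_mk'.comp
    (continuous_subtype_val.comp continuous_subtype_val)) _

lemma GG_open (n : ℕ) : IsOpenMap (GG n) := by
  intro U hU
  obtain ⟨V0, hV0, rfl⟩ := isOpen_induced_iff.1 hU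
  obtain ⟨V, hV, rfl⟩ := isOpen_induced_iff.1 hV0
  have : GG n '' (Subtype.val ⁻¹' (Subtype.val ⁻¹' V)) =
      Subtype.val ⁻¹' (Quotient.mk (ringSetoid n) '' (V ∩ {f | IsSorted f})) := by
    ext ⟨x, hx⟩
    constructor
    · rintro ⟨f, hf, h⟩
      exact ⟨f.1.1, ⟨hf, f.2⟩, congrArg Subtype.val h⟩
    · rintro ⟨f, ⟨hf, hs⟩, h⟩
      obtain ⟨g, hg, hu, hi⟩ := hx
      obtain ⟨τ, e, rfl⟩ := mk_eq g f (hg.trans h.symm)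
      exact ⟨⟨⟨_, untw_act τ e g hu⟩, hs⟩, hf, Subtype.ext h⟩
  rw [this]
  exact (mk_open n _ (hV.inter (isSorted_open n))).preimage continuous_subtype_val

lemma GG_inj (n : ℕ) : Function.Injective (GG n) := by
  intro f g h
  obtain ⟨τ, e, hg⟩ := mk_eq f.1.1 g.1.1 (congrArg Subtype.val h)
  have hnorm : ∀ i, ‖(g.1.1.1 i).2‖ = ‖(f.1.1.1 (τ i)).2‖ := by
    intro i; rw [hg]; exact sgn_norm _ _
  have hτ : StrictMono τ := by
    intro i j hij
    have := g.2.1 hij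
    simp only [hnorm] at this
    exact f.2.1.lt_iff_lt.1 this
  have hτ1 : ∀ i, τ i = i := by
    intro i
    have := (StrictMono.range_inj hτ strictMono_id).1 (by simp [τ.surjective.range_eq])
    exact congrFun this i
  apply Subtype.ext; apply Subtype.ext
  rw [hg]
  apply Subtype.ext
  funext i
  have h0 : 0 < (g.1.1.1 i).2 0 := g.2.2 i
  have h1 : 0 < (f.1.1.1 i).2 0 := f.2.2 i
  rw [hg] at h0
  simp only [act, hτ1] at h0 ⊢
  rcases unit_cases (e i) with he | he
  · simp [sgn, he]
  · simp [sgn, he] at h0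
    linarith

lemma GG_surj (n : ℕ) : Function.Surjective (GG n) := by
  rintro ⟨x, f, rfl, hu, hi⟩
  let τ := Tuple.sort fun i => ‖(f.1 i).2‖
  have hm := Tuple.monotone_sort fun i => ‖(f.1 i).2‖
  have hs : StrictMono ((fun i => ‖(f.1 i).2‖) ∘ τ) :=
    hm.strictMono_of_injective (hi.comp τ.injective)
  let e : Fin n → ℤˣ := fun i => if 0 < (f.1 (τ i)).2 0 then 1 else -1
  refine ⟨⟨⟨act τ e f, untw_act τ e f hu⟩, ?_, ?_⟩, Subtype.ext (mk_act _ _ _)⟩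
  · simp only [act, sgn_norm]; exact hs
  · intro i
    simp only [act, sgn, e]
    split_ifs with h
    · simpa using h
    · have : (f.1 (τ i)).2 0 ≠ 0 := fun h0 => f.2.1 (τ i) (by
        ext k; fin_cases k
        · exact h0
        · exact (hu _).1
        · exact (hu _).2)
      have : (f.1 (τ i)).2 0 < 0 := lt_of_le_of_ne (not_lt.1 h) this
      simpa using this

def GH (n : ℕ) : SortedT n ≃ₜ ↥(URlt n) :=
  (Equiv.ofBijective (GG n) ⟨GG_inj n, GG_surj n⟩).toHomeomorphOfContinuousOpen
    (GG_cont n) (GG_open n)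

lemma untw_w0 {w : E3} (h1 : w 1 = 0) (h2 : w 2 = 0) (hw : w ≠ 0) : w 0 ≠ 0 := fun h0 => hw (by
  ext k; fin_cases k
  · exact h0
  · exact h1
  · exact h2)

lemma untw_inner {w : E3} (h1 : w 1 = 0) (h2 : w 2 = 0) (hw : w ≠ 0) (x : E3) :
    inner ℝ x w = (0 : ℝ) ↔ x 0 = 0 := by
  rw [E3_inner, h1, h2]; simp [untw_w0 h1 h2 hw]

/-- two coplanar round circles whose radii satisfy the triangle inequalities meet -/
lemma circles_meet (c c' : E3) (r r' : ℝ) (hr : 0 < r) (hr' : 0 < r') (h0 : c 0 = c' 0)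
    (h1 : ‖c - c'‖ ≤ r + r') (h2 : |r - r'| ≤ ‖c - c'‖) :
    ∃ y : E3, y 0 = c 0 ∧ ‖y - c‖ = r ∧ ‖y - c'‖ = r' := by
  by_cases hd : c = c'
  · subst hd
    have : r = r' := by
      simp only [sub_self, norm_zero] at h2
      have := abs_nonpos_iff.1 h2
      linarith
    subst this
    refine ⟨c + r • ee, by simp [ee_zero], ?_, ?_⟩ <;>
      rw [add_sub_cancel_left, norm_smul, ee_norm, Real.norm_eq_abs, abs_of_pos hr, mul_one]
  · set p := c' 1 - c 1 with hp
    set q := c' 2 - c 2 with hq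
    have hD : ‖c - c'‖ ^ 2 = p ^ 2 + q ^ 2 := by
      rw [EuclideanSpace.real_norm_sq_eq, Fin.sum_univ_three]
      simp only [PiLp.sub_apply, h0, hp, hq]; ring
    have hdpos : 0 < ‖c - c'‖ := norm_pos_iff.2 (sub_ne_zero.2 hd)
    set d := ‖c - c'‖ with hdd
    obtain ⟨l1, l2⟩ := abs_le.1 h2
    have hk : 0 ≤ (r + r') ^ 2 - d ^ 2 := by nlinarith
    have hk2 : 0 ≤ d ^ 2 - (r - r') ^ 2 := by nlinarith
    set α := (r ^ 2 - r' ^ 2 + d ^ 2) / (2 * d ^ 2) with hα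
    have hα' : 2 * α * d ^ 2 = r ^ 2 - r' ^ 2 + d ^ 2 := by rw [hα]; field_simp
    have hnn : 0 ≤ (r ^ 2 - α ^ 2 * d ^ 2) / d ^ 2 := by
      have : (r ^ 2 - α ^ 2 * d ^ 2) / d ^ 2
          = ((r + r') ^ 2 - d ^ 2) * (d ^ 2 - (r - r') ^ 2) / (4 * d ^ 4) := by
        rw [hα]; field_simp; ring
      rw [this]; positivity
    set β := Real.sqrt ((r ^ 2 - α ^ 2 * d ^ 2) / d ^ 2) with hβ
    have hβ2 : β ^ 2 * d ^ 2 = r ^ 2 - α ^ 2 * d ^ 2 := by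
      rw [hβ, Real.sq_sqrt hnn]; field_simp
    rw [hD] at hβ2 hα'
    refine ⟨!₂[c 0, c 1 + (α * p - β * q), c 2 + (α * q + β * p)], by simp, ?_, ?_⟩
    · rw [E3_norm_eq _ _ hr.le]
      simp
      linear_combination hβ2
    · rw [E3_norm_eq _ _ hr'.le]
      have e1 : c' 1 = c 1 + p := by rw [hp]; ring
      have e2 : c' 2 = c 2 + q := by rw [hq]; ring
      simp [h0, e1, e2]
      linear_combination hβ2 - hα'

lemma valid_of_ring {n : ℕ} (f : RingTuple n) (hf : IsUntwistedTuple f) :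
    Valid fun i => ((f.1 i).1, ‖(f.1 i).2‖) := by
  refine ⟨fun i => norm_pos_iff.2 (f.2.1 i), fun i j hij => ?_⟩
  by_contra hneg
  have h := not_lt.1 hneg
  unfold gm at h
  simp only at h
  set c := (f.1 i).1
  set c' := (f.1 j).1
  set r := ‖(f.1 i).2‖
  set r' := ‖(f.1 j).2‖
  have a1 := abs_nonneg (c 0 - c' 0)
  have a2 := le_max_left 0 (max (‖c - c'‖ - r - r') (|r - r'| - ‖c - c'‖))
  have a3 := le_max_right 0 (max (‖c - c'‖ - r - r') (|r - r'| - ‖c - c'‖))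
  have a4 := le_max_left (‖c - c'‖ - r - r') (|r - r'| - ‖c - c'‖)
  have a5 := le_max_right (‖c - c'‖ - r - r') (|r - r'| - ‖c - c'‖)
  have h0 : c 0 = c' 0 := by
    have : |c 0 - c' 0| = 0 := by linarith
    exact sub_eq_zero.1 (abs_eq_zero.1 this)
  obtain ⟨y, hy0, hy1, hy2⟩ := circles_meet c c' r r' (norm_pos_iff.2 (f.2.1 i))
    (norm_pos_iff.2 (f.2.1 j)) h0 (by linarith) (by linarith)
  have hdis := Set.disjoint_left.1 (f.2.2.1 i j hij)
  refine @hdis y ?_ ?_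
  · rw [mem_pCircle, untw_inner (hf i).1 (hf i).2 (f.2.1 i)]
    exact ⟨hy1, by rw [PiLp.sub_apply, hy0]; exact sub_self _⟩
  · rw [mem_pCircle, untw_inner (hf j).1 (hf j).2 (f.2.1 j)]
    exact ⟨hy2, by rw [PiLp.sub_apply, hy0, h0]; exact sub_self _⟩

def xx (r : ℝ) : E3 := EuclideanSpace.single 0 r
lemma xx_norm {r : ℝ} (hr : 0 < r) : ‖xx r‖ = r := by simp [xx, abs_of_pos hr]
lemma xx_0 (r : ℝ) : xx r 0 = r := by simp [xx]
lemma xx_1 (r : ℝ) : xx r 1 = 0 := by simp [xx]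
lemma xx_2 (r : ℝ) : xx r 2 = 0 := by simp [xx]
lemma xx_ne {r : ℝ} (hr : 0 < r) : xx r ≠ 0 := norm_pos_iff.1 (by rw [xx_norm hr]; exact hr)
lemma xx_cont : Continuous xx := by
  unfold xx
  exact (PiLp.continuous_toLp 2 _).comp (continuous_single (A := fun _ : Fin 3 => ℝ) 0)

lemma mem_xxC (p : E3 × ℝ) (hp : 0 < p.2) (y : E3) :
    y ∈ pCircle (p.1, xx p.2) ↔ y 0 = p.1 0 ∧ ‖y - p.1‖ = p.2 := by
  rw [mem_pCircle, untw_inner (xx_1 _) (xx_2 _) (xx_ne hp), xx_norm hp, PiLp.sub_apply, sub_eq_zero,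
    and_comm]
lemma mem_xxD (p : E3 × ℝ) (hp : 0 < p.2) (y : E3) :
    y ∈ pDisk (p.1, xx p.2) ↔ y 0 = p.1 0 ∧ ‖y - p.1‖ ≤ p.2 := by
  rw [mem_pDisk, untw_inner (xx_1 _) (xx_2 _) (xx_ne hp), xx_norm hp, PiLp.sub_apply, sub_eq_zero,
    and_comm]

lemma not_links (p q : E3 × ℝ) (hp : 0 < p.2) (hq : 0 < q.2) (h : 0 < gm p q) :
    ¬ LinksOnce (p.1, xx p.2) (q.1, xx q.2) := by
  rintro ⟨x, ⟨hx1, hx2⟩, hu⟩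
  rw [mem_xxC p hp] at hx1
  rw [mem_xxD q hq] at hx2
  unfold gm at h
  have h0 : p.1 0 = q.1 0 := by rw [← hx1.1, hx2.1]
  rw [h0, sub_self, abs_zero, zero_add, lt_max_iff, lt_max_iff] at h
  have t1 : ‖p.1 - q.1‖ ≤ ‖x - p.1‖ + ‖x - q.1‖ := by
    have := norm_sub_le (x - q.1) (x - p.1)
    rw [sub_sub_sub_cancel_left] at this; linarith
  have t2 : ‖x - p.1‖ ≤ ‖x - q.1‖ + ‖p.1 - q.1‖ := by
    have := norm_sub_le (x - q.1) (p.1 - q.1)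
    rw [sub_sub_sub_cancel_right] at this; linarith
  rcases h with h | h | h
  · exact lt_irrefl _ h
  · linarith [hx1.2, hx2.2]
  · rcases abs_cases (p.2 - q.2) with h' | h'
    · linarith [hx1.2, hx2.2]
    · have key : ∀ v : E3, v 0 = 0 → ‖v‖ = p.2 → p.1 + v = x := by
        intro v hv0 hv
        apply hu
        refine ⟨(mem_xxC p hp _).2 ⟨by simp [hv0], by simp [hv]⟩, (mem_xxD q hq _).2
          ⟨by simp [hv0, h0], ?_⟩⟩
        have := norm_add_le (p.1 - q.1) v
        rw [add_sub_right_comm]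
        linarith
      have n1 : ‖p.2 • ee‖ = p.2 := by
        rw [norm_smul, ee_norm, Real.norm_eq_abs, abs_of_pos hp, mul_one]
      have k1 := key (p.2 • ee) (by simp [ee_zero]) n1
      have k2 := key (-(p.2 • ee)) (by simp [ee_zero]) (by rw [norm_neg, n1])
      have k3 := add_left_cancel (k1.trans k2.symm)
      have k4 : p.2 • ee = 0 := by
        have k5 : (2 : ℝ) • (p.2 • ee) = 0 := by
          rw [two_smul]; nth_rewrite 1 [k3]; exact neg_add_cancel _
        simpa using k5
      rw [k4, norm_zero] at n1
      linarith

lemma ring_of_valid {n : ℕ} (b : Fin n → E3 × ℝ) (hb : Valid b) :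
    IsRingTuple fun i => ((b i).1, xx (b i).2) := by
  refine ⟨fun i => xx_ne (hb.1 i), fun i j hij => ?_, fun i j hij => ⟨?_, ?_⟩⟩
  · rw [Set.disjoint_left]
    intro y hy1 hy2
    rw [mem_xxC _ (hb.1 i)] at hy1
    rw [mem_xxC _ (hb.1 j)] at hy2
    have h1 := gm_le_gd (b i) (b j) y (gd_eq_zero.2 hy2)
    rw [gd_eq_zero.2 hy1] at h1
    linarith [hb.2 i j hij]
  · exact not_links _ _ (hb.1 i) (hb.1 j) (hb.2 i j hij)
  · exact not_links _ _ (hb.1 j) (hb.1 i) (hb.2 j i hij.symm)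

lemma tup_cont (n : ℕ) : Continuous fun f : PURTuple n => fun i => ((f.1.1 i).1, ‖(f.1.1 i).2‖) := by
  refine continuous_pi fun i => ?_
  have : Continuous fun f : PURTuple n => f.1.1 i :=
    (continuous_apply i).comp (continuous_subtype_val.comp continuous_subtype_val)
  exact this.fst.prodMk this.snd.norm

def toBC (n : ℕ) : C(PURTuple n, BC n) :=
  ⟨fun f => ⟨fun i => ((f.1.1 i).1, ‖(f.1.1 i).2‖), valid_of_ring f.1 f.2⟩,
    Continuous.subtype_mk (tup_cont n) _⟩

def toAC (n : ℕ) : C(SortedT n, AC n) :=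
  ⟨fun f => ⟨fun i => ((f.1.1.1 i).1, ‖(f.1.1.1 i).2‖), valid_of_ring f.1.1 f.1.2, f.2.1⟩,
    Continuous.subtype_mk ((tup_cont n).comp continuous_subtype_val) _⟩

def ofAC (n : ℕ) : C(AC n, SortedT n) :=
  ⟨fun b => ⟨⟨⟨fun i => ((b.1 i).1, xx (b.1 i).2), ring_of_valid b.1 b.2.1⟩,
    fun i => ⟨xx_1 _, xx_2 _⟩⟩, by
      refine ⟨?_, fun i => ?_⟩
      · simp only [fun i => xx_norm (b.2.1.1 i)]; exact b.2.2
      · simp only [xx_0]; exact b.2.1.1 i⟩, by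
    refine Continuous.subtype_mk (Continuous.subtype_mk (Continuous.subtype_mk
      (continuous_pi fun i => ?_) _) _) _
    have : Continuous fun b : AC n => b.1 i := (continuous_apply i).comp continuous_subtype_val
    exact this.fst.prodMk (xx_cont.comp this.snd)⟩

lemma of_to (n : ℕ) (f : SortedT n) : ofAC n (toAC n f) = f := by
  apply Subtype.ext; apply Subtype.ext; apply Subtype.ext
  funext i
  refine Prod.ext rfl ?_
  show xx ‖(f.1.1.1 i).2‖ = (f.1.1.1 i).2
  have h0 := f.2.2 i
  have h1 := f.1.2 i
  have : ‖(f.1.1.1 i).2‖ = (f.1.1.1 i).2 0 := by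
    rw [E3_norm_eq _ _ h0.le, h1.1, h1.2]; ring
  rw [this]
  ext k; fin_cases k
  · exact xx_0 _
  · exact (xx_1 _).trans h1.1.symm
  · exact (xx_2 _).trans h1.2.symm

lemma sorted_null {n : ℕ} (x : SortedT n) (γ : Path x x)
    (h : (γ.map (continuous_subtype_val)).Homotopic (Path.refl x.1)) :
    γ.Homotopic (Path.refl x) := by
  have h1 := injAB n _ (γ.map (toAC n).continuous) (h.map (toBC n))
  have h2 := (h1.map (ofAC n)).pathCast (of_to n x).symm (of_to n x).symm
  have k1 : ((γ.map (toAC n).continuous).map (ofAC n).continuous).cast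
      (of_to n x).symm (of_to n x).symm = γ := by
    ext t : 2
    exact of_to n _
  have k2 : ((Path.refl (toAC n x)).map (ofAC n).continuous).cast
      (of_to n x).symm (of_to n x).symm = Path.refl x := by
    ext t : 2
    exact of_to n _
  rw [← k1, ← k2]
  exact h2

def FF (n : ℕ) : C(↥(URlt n), PURTuple n) :=
  ⟨fun x => ((GH n).symm x).1, continuous_subtype_val.comp (GH n).symm.continuous⟩

lemma GH_mk (n : ℕ) (x : ↥(URlt n)) : Quotient.mk (ringSetoid n) (FF n x).1 = x.1 :=
  congrArg Subtype.val ((GH n).apply_symm_apply x)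

lemma FF_null (n : ℕ) (x : ↥(URlt n)) (γ : Path x x)
    (h : (γ.map (FF n).continuous).Homotopic (Path.refl (FF n x))) : γ.Homotopic (Path.refl x) := by
  have h1 := sorted_null _ (γ.map (GH n).symm.continuous) h
  have e := ((GH n).apply_symm_apply x).symm
  have h2 := (h1.map ⟨GH n, (GH n).continuous⟩).pathCast e e
  have k1 : ((γ.map (GH n).symm.continuous).map (GH n).continuous).cast e e = γ := by
    ext t : 2
    exact (GH n).apply_symm_apply _
  have k2 : ((Path.refl ((GH n).symm x)).map (GH n).continuous).cast e e = Path.refl x := by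
    ext t : 2
    exact (GH n).apply_symm_apply _
  rw [← k1, ← k2]
  exact h2

lemma pi1_inj {X Y : Type} [TopologicalSpace X] [TopologicalSpace Y] (f : C(X, Y)) (x : X)
    (h : ∀ γ : Path x x, (γ.map f.continuous).Homotopic (Path.refl (f x)) →
      γ.Homotopic (Path.refl x)) : Function.Injective (pi1Map f x) := by
  rw [injective_iff_map_eq_one]
  intro g hg
  have hg1 : (pi1Map f x g).hom = 𝟙 _ := by rw [hg]; rfl
  obtain ⟨γ, hγ⟩ := Path.Homotopic.Quotient.mk_surjective g.hom
  apply Iso.ext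
  show g.hom = 𝟙 _
  rw [← hγ]
  have : Path.Homotopic.Quotient.mk (γ.map f.continuous) =
      Path.Homotopic.Quotient.mk (Path.refl (f x)) := by
    have h3 : (pi1Map f x g).hom = Path.Homotopic.Quotient.map g.hom f := rfl
    rw [h3, ← hγ] at hg1
    exact hg1
  exact Quotient.sound (h γ (Quotient.exact this))

/-- Ordering the circles of each configuration by increasing radius defines an
embedding `𝒰ℛ^<_n ↪ 𝒫𝒰ℛ_n`, and the induced homomorphism on fundamental groups is
injective. -/
theorem statement14 (n : ℕ) :
    ∃ F : C(↥(URlt n), PURTuple n),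
      (∀ x : ↥(URlt n), Quotient.mk (ringSetoid n) (F x).1 = x.1 ∧
        StrictMono fun i => ‖(((F x).1).1 i).2‖) ∧
      Topology.IsEmbedding F ∧
      ∀ x : ↥(URlt n), Function.Injective (pi1Map F x) := by
  refine ⟨FF n, fun x => ⟨GH_mk n x, ((GH n).symm x).2.1⟩, ?_, fun x => pi1_inj _ _ (FF_null n x)⟩
  exact Topology.IsEmbedding.subtypeVal.comp (GH n).symm.isEmbedding
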